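/- Let Ω ⊂ ℝⁿ be open, v ∈ C^{1,α}(Ω, ℝ^m) with v^♯e ∈ C², and φ a standard symmetric convolution kernel. Then for every compact K ⊂ Ω, ‖(v∗φ_ε)^♯e − v^♯e‖_{C¹(K)} = O(ε^{2α−1}) as ε → 0. -/

import Mathlib

open MeasureTheory

/-- Components of the pullback metric `u^♯e`: `(u^♯e)_{ij}(x) = Σ_k ∂_i u^k ∂_j u^k (x)`. -/
noncomputable def pullMetric (n m : ℕ) (u : (Fin n → ℝ) → Fin m → ℝ) (i j : Fin n)
    (x : Fin n → ℝ) : ℝ :=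
  ∑ k, fderiv ℝ u x (Pi.single i 1) k * fderiv ℝ u x (Pi.single j 1) k

/-- Mollification `v ∗ φ_ε` of a vector-valued map, `φ_ε(y) = ε^{-n} φ(y/ε)`. -/
noncomputable def mollMap (n m : ℕ) (φ : (Fin n → ℝ) → ℝ) (ε : ℝ)
    (v : (Fin n → ℝ) → Fin m → ℝ) (x : Fin n → ℝ) : Fin m → ℝ :=
  ∫ y, ((ε ^ n)⁻¹ * φ (ε⁻¹ • y)) • v (x - y)

open Convolution ContinuousLinearMap

section Mollification

variable {E F : Type*} [NormedAddCommGroup E] [NormedSpace ℝ E] [FiniteDimensional ℝ E]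
  [MeasurableSpace E] {μ : Measure E}
  [NormedAddCommGroup F] [NormedSpace ℝ F] {ψ : E → ℝ} {R : ℝ}

/-- A nonnegative `C¹` kernel of mass one compactly supported in the open ball of radius `R`. -/
structure IsMollifier (μ : Measure E) (ψ : E → ℝ) (R : ℝ) : Prop where
  contDiff : ContDiff ℝ 1 ψ
  nonneg : ∀ x, 0 ≤ ψ x
  integral_eq_one : ∫ x, ψ x ∂μ = 1
  tsupport_subset : tsupport ψ ⊆ Metric.ball 0 R

namespace IsMollifier

theorem hasCompactSupport (h : IsMollifier μ ψ R) : HasCompactSupport ψ :=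
  .of_support_subset_isCompact (isCompact_closedBall 0 R)
    ((subset_tsupport ψ).trans (h.tsupport_subset.trans Metric.ball_subset_closedBall))

variable [BorelSpace E] [μ.IsAddHaarMeasure]

theorem convolutionExists (h : IsMollifier μ ψ R) {f : E → F} (hf : Continuous f) :
    ConvolutionExists ψ f (lsmul ℝ ℝ) μ :=
  h.hasCompactSupport.convolutionExists_left _ h.contDiff.continuous hf.locallyIntegrable

theorem norm_convolution_sub_le (h : IsMollifier μ ψ R) [CompleteSpace F] {f : E → F}
    (hf : Continuous f) {x : E} {z : F} {δ : ℝ} (hδ : 0 ≤ δ)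
    (hfx : ∀ y ∈ Metric.ball x R, ‖f y - z‖ ≤ δ) :
    ‖(ψ ⋆[lsmul ℝ ℝ, μ] f) x - z‖ ≤ δ := by
  rw [← dist_eq_norm]
  refine dist_convolution_le hδ ((subset_tsupport ψ).trans h.tsupport_subset) h.nonneg
    h.integral_eq_one hf.aestronglyMeasurable fun y hy => ?_
  rw [dist_eq_norm]
  exact hfx y hy

theorem hasFDerivAt_convolution (h : IsMollifier μ ψ R) {f : E → ℝ} (hf : Continuous f) (x : E) :
    HasFDerivAt (ψ ⋆[lsmul ℝ ℝ, μ] f)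
      ((fderiv ℝ ψ ⋆[(lsmul ℝ ℝ).precompL E, μ] f) x) x :=
  h.hasCompactSupport.hasFDerivAt_convolution_left _ h.contDiff hf.locallyIntegrable x

theorem norm_fderiv_convolution_le (h : IsMollifier μ ψ R) {f : E → ℝ} (hf : Continuous f)
    {x : E} {δ : ℝ} (hδ : 0 ≤ δ) (hfx : ∀ y ∈ Metric.ball x R, ‖f y‖ ≤ δ) :
    ‖fderiv ℝ (ψ ⋆[lsmul ℝ ℝ, μ] f) x‖ ≤ (∫ y, ‖fderiv ℝ ψ y‖ ∂μ) * δ := by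
  have hint : Integrable (fderiv ℝ ψ) μ :=
    (h.contDiff.continuous_fderiv one_ne_zero).integrable_of_hasCompactSupport
      (h.hasCompactSupport.fderiv ℝ)
  have hL := (norm_precompL_le E (lsmul ℝ ℝ : ℝ →L[ℝ] ℝ →L[ℝ] ℝ)).trans opNorm_lsmul_le
  have key := dist_convolution_le' (z₀ := 0) ((lsmul ℝ ℝ : ℝ →L[ℝ] ℝ →L[ℝ] ℝ).precompL E) hδ hint
    ((support_fderiv_subset ℝ).trans h.tsupport_subset) hf.aestronglyMeasurable
    (x₀ := x) (by simpa using hfx)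
  simp only [map_zero, integral_zero, dist_zero_right] at key
  rw [(h.hasFDerivAt_convolution hf x).fderiv]
  refine key.trans (mul_le_mul_of_nonneg_right ?_ hδ)
  exact mul_le_of_le_one_left (by positivity) hL

/-- Differentiating a mollified `C¹` map amounts to mollifying its derivative. -/
theorem hasFDerivAt_convolution_of_contDiff (h : IsMollifier μ ψ R) [CompleteSpace F] {f : E → F}
    (hf : ContDiff ℝ 1 f) (hfc : HasCompactSupport f) (x : E) :
    HasFDerivAt (ψ ⋆[lsmul ℝ ℝ, μ] f) ((ψ ⋆[lsmul ℝ ℝ, μ] fderiv ℝ f) x) x :=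
  hfc.hasFDerivAt_convolution_right _ h.contDiff.continuous.locallyIntegrable hf x

theorem clm_convolution (h : IsMollifier μ ψ R) {G : Type*} [NormedAddCommGroup G]
    [NormedSpace ℝ G] [CompleteSpace F] [CompleteSpace G]
    {f : E → F} (hf : Continuous f) (T : F →L[ℝ] G) (x : E) :
    T ((ψ ⋆[lsmul ℝ ℝ, μ] f) x) = (ψ ⋆[lsmul ℝ ℝ, μ] fun y => T (f y)) x := by
  rw [convolution_def, convolution_def, ← T.integral_comp_comm (h.convolutionExists hf x)]
  simp

theorem convolution_sub_mul_sub (h : IsMollifier μ ψ R) {a b : E → ℝ} (ha : Continuous a)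
    (hb : Continuous b) (c d : ℝ) (x : E) :
    (ψ ⋆[lsmul ℝ ℝ, μ] fun y => (a y - c) * (b y - d)) x =
      (ψ ⋆[lsmul ℝ ℝ, μ] fun y => a y * b y) x - c * (ψ ⋆[lsmul ℝ ℝ, μ] b) x
        - d * (ψ ⋆[lsmul ℝ ℝ, μ] a) x + c * d := by
  have i1 : Integrable (fun y => ψ y * (a (x - y) * b (x - y))) μ :=
    h.convolutionExists (ha.mul hb) x
  have i2 : Integrable (fun y => c * (ψ y * b (x - y))) μ :=
    (h.convolutionExists hb x).integrable.const_mul c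
  have i3 : Integrable (fun y => d * (ψ y * a (x - y))) μ :=
    (h.convolutionExists ha x).integrable.const_mul d
  have i4 : Integrable (fun y => ψ y * (c * d)) μ :=
    (integrable_of_integral_eq_one h.integral_eq_one).mul_const _
  have i12 : Integrable (fun y => ψ y * (a (x - y) * b (x - y)) - c * (ψ y * b (x - y))) μ :=
    i1.sub i2
  have i123 : Integrable (fun y => ψ y * (a (x - y) * b (x - y)) - c * (ψ y * b (x - y))
      - d * (ψ y * a (x - y))) μ := i12.sub i3
  calc _ = ∫ y, (ψ y * (a (x - y) * b (x - y)) - c * (ψ y * b (x - y))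
            - d * (ψ y * a (x - y)) + ψ y * (c * d)) ∂μ := by
        refine integral_congr_ae (.of_forall fun y => ?_)
        simp only [lsmul_apply, smul_eq_mul]
        ring
    _ = _ := by
        rw [integral_add i123 i4, integral_sub i12 i3, integral_sub i1 i2,
          integral_const_mul, integral_const_mul, integral_mul_const, h.integral_eq_one, one_mul]
        rfl

/-- Constantin–E–Titi commutator estimate, in `C¹`. -/
theorem commutator_estimate (h : IsMollifier μ ψ R) {a b : E → ℝ} (ha : Continuous a)
    (hb : Continuous b) {x : E} {δ : ℝ} (hδ : 0 ≤ δ)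
    (hax : ∀ y ∈ Metric.ball x R, |a y - a x| ≤ δ)
    (hbx : ∀ y ∈ Metric.ball x R, |b y - b x| ≤ δ) :
    ∃ D : E →L[ℝ] ℝ,
      HasFDerivAt (fun y => (ψ ⋆[lsmul ℝ ℝ, μ] a) y * (ψ ⋆[lsmul ℝ ℝ, μ] b) y -
        (ψ ⋆[lsmul ℝ ℝ, μ] fun y => a y * b y) y) D x ∧
      |(ψ ⋆[lsmul ℝ ℝ, μ] a) x * (ψ ⋆[lsmul ℝ ℝ, μ] b) x -
        (ψ ⋆[lsmul ℝ ℝ, μ] fun y => a y * b y) x| ≤ (2 * δ) ^ 2 ∧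
      ‖D‖ ≤ (∫ y, ‖fderiv ℝ ψ y‖ ∂μ) * (2 * δ) ^ 2 := by
  set A := ψ ⋆[lsmul ℝ ℝ, μ] a with hA
  set B := ψ ⋆[lsmul ℝ ℝ, μ] b with hB
  set g : E → ℝ := fun y => (a y - A x) * (b y - B x) with hg_def
  have hg : Continuous g := by fun_prop
  have close : ∀ {f : E → ℝ}, Continuous f → (∀ y ∈ Metric.ball x R, |f y - f x| ≤ δ) →
      ∀ y ∈ Metric.ball x R, |f y - (ψ ⋆[lsmul ℝ ℝ, μ] f) x| ≤ 2 * δ := by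
    intro f hf hfx y hy
    have h1 := h.norm_convolution_sub_le hf hδ hfx
    rw [Real.norm_eq_abs, abs_sub_comm] at h1
    have h2 := abs_sub_le (f y) (f x) ((ψ ⋆[lsmul ℝ ℝ, μ] f) x)
    linarith [hfx y hy]
  have hgx : ∀ y ∈ Metric.ball x R, ‖g y‖ ≤ (2 * δ) ^ 2 := by
    intro y hy
    rw [hg_def, Real.norm_eq_abs, abs_mul, sq]
    exact mul_le_mul (close ha hax y hy) (close hb hbx y hy) (abs_nonneg _) (by positivity)
  have key : (fun y => A y * B y - (ψ ⋆[lsmul ℝ ℝ, μ] fun y => a y * b y) y) =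
      fun y => (A y - A x) * (B y - B x) - (ψ ⋆[lsmul ℝ ℝ, μ] g) y := by
    funext y
    rw [hg_def, h.convolution_sub_mul_sub ha hb]
    ring
  refine ⟨-fderiv ℝ (ψ ⋆[lsmul ℝ ℝ, μ] g) x, ?_, ?_, ?_⟩
  · rw [key]
    have h1 := ((h.hasFDerivAt_convolution ha x).sub_const (A x)).mul
      ((h.hasFDerivAt_convolution hb x).sub_const (B x))
    have h2 := (h.hasFDerivAt_convolution hg x).differentiableAt.hasFDerivAt
    convert! h1.sub h2 using 1
    simp [← hA, ← hB]
  · have := congrFun key x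
    simp only [sub_self, zero_mul, zero_sub] at this
    rw [this, abs_neg]
    simpa using h.norm_convolution_sub_le hg (z := 0) (by positivity) (by simpa using hgx)
  · rw [norm_neg]
    exact h.norm_fderiv_convolution_le hg (by positivity) hgx

theorem convolution_sub_self_estimate (h : IsMollifier μ ψ R) {g : E → ℝ} (hg : ContDiff ℝ 1 g)
    (hgc : HasCompactSupport g) {L : NNReal} (hL : LipschitzWith L g)
    (hL' : LipschitzWith L (fderiv ℝ g)) (hR : 0 ≤ R) (x : E) :
    ∃ D : E →L[ℝ] ℝ,
      HasFDerivAt (fun y => (ψ ⋆[lsmul ℝ ℝ, μ] g) y - g y) D x ∧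
      |(ψ ⋆[lsmul ℝ ℝ, μ] g) x - g x| ≤ L * R ∧ ‖D‖ ≤ L * R := by
  refine ⟨_, (h.hasFDerivAt_convolution_of_contDiff hg hgc x).sub
    (hg.differentiable one_ne_zero x).hasFDerivAt, ?_, ?_⟩
  · refine h.norm_convolution_sub_le hg.continuous (by positivity) fun y hy => ?_
    refine (hL.norm_sub_le y x).trans ?_
    gcongr
    exact (mem_ball_iff_norm.1 hy).le
  · refine h.norm_convolution_sub_le (hg.continuous_fderiv one_ne_zero) (by positivity)
      fun y hy => ?_
    refine (hL'.norm_sub_le y x).trans ?_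
    gcongr
    exact (mem_ball_iff_norm.1 hy).le

end IsMollifier

end Mollification

namespace IsMollifier

variable {E F : Type*} [NormedAddCommGroup E] [NormedSpace ℝ E] [MeasurableSpace E]
  [NormedAddCommGroup F] [NormedSpace ℝ F] {μ : Measure E} {ψ : E → ℝ} {R : ℝ}

theorem convolution_congr_of_eqOn_ball (h : IsMollifier μ ψ R) {f g : E → F} {x : E}
    (hfg : Set.EqOn f g (Metric.ball x R)) :
    (ψ ⋆[lsmul ℝ ℝ, μ] f) x = (ψ ⋆[lsmul ℝ ℝ, μ] g) x := by
  refine integral_congr_ae (.of_forall fun y => ?_)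
  by_cases hy : ψ y = 0
  · simp [hy]
  · have hyR := h.tsupport_subset (subset_tsupport ψ hy)
    have : f (x - y) = g (x - y) := hfg (by simpa using hyR)
    simp only [this]

end IsMollifier

section Rescaling

variable {n : ℕ} {φ : (Fin n → ℝ) → ℝ} {ε : ℝ}

theorem isMollifier_rescale (hφ : ContDiff ℝ 1 φ) (hφ0 : ∀ x, 0 ≤ φ x)
    (hφsupp : tsupport φ ⊆ Metric.closedBall 0 1) (hφint : ∫ x, φ x = 1) (hε : 0 < ε) :
    IsMollifier volume (fun y => (ε ^ n)⁻¹ * φ (ε⁻¹ • y)) (2 * ε) where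
  contDiff := contDiff_const.mul (hφ.comp (contDiff_const_smul _))
  nonneg x := mul_nonneg (by positivity) (hφ0 _)
  integral_eq_one := by
    rw [integral_const_mul, Measure.integral_comp_inv_smul, hφint]
    simp [abs_of_pos hε, hε.ne']
  tsupport_subset := by
    refine (closure_minimal ?_ Metric.isClosed_closedBall).trans
      (Metric.closedBall_subset_ball (by linarith : ε < 2 * ε))
    intro y hy
    have hy' : φ (ε⁻¹ • y) ≠ 0 := right_ne_zero_of_mul hy
    have := hφsupp (subset_tsupport φ hy')
    rw [mem_closedBall_zero_iff, norm_smul, norm_inv, Real.norm_of_nonneg hε.le,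
      inv_mul_le_iff₀ hε, mul_one] at this
    rwa [mem_closedBall_zero_iff]

theorem integral_norm_fderiv_rescale (hφ : ContDiff ℝ 1 φ) (hε : 0 < ε) :
    ∫ y, ‖fderiv ℝ (fun y => (ε ^ n)⁻¹ * φ (ε⁻¹ • y)) y‖ = ε⁻¹ * ∫ y, ‖fderiv ℝ φ y‖ := by
  have hd : ∀ y, ‖fderiv ℝ (fun y => (ε ^ n)⁻¹ * φ (ε⁻¹ • y)) y‖ =
      ((ε ^ n)⁻¹ * ε⁻¹) * ‖fderiv ℝ φ (ε⁻¹ • y)‖ := by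
    intro y
    rw [fderiv_const_mul, fderiv_comp_smul, norm_smul, norm_smul,
      Real.norm_of_nonneg (by positivity), Real.norm_of_nonneg (by positivity), mul_assoc]
    exact (hφ.differentiable one_ne_zero).differentiableAt.comp _ (by fun_prop)
  simp_rw [hd]
  rw [integral_const_mul, Measure.integral_comp_inv_smul volume fun y => ‖fderiv ℝ φ y‖]
  simp only [Module.finrank_fin_fun, abs_of_pos (pow_pos hε n), smul_eq_mul]
  field_simp

end Rescaling

section Cutoff

variable {E F : Type*} [NormedAddCommGroup E] [NormedSpace ℝ E]
  [NormedAddCommGroup F] [NormedSpace ℝ F]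

theorem exists_contDiff_cutoff [FiniteDimensional ℝ E] {K Ω : Set E} (hK : IsCompact K)
    (hΩ : IsOpen Ω) (hKΩ : K ⊆ Ω) :
    ∃ δ > 0, ∃ χ : E → ℝ, ContDiff ℝ 2 χ ∧ HasCompactSupport χ ∧ tsupport χ ⊆ Ω ∧
      Set.EqOn χ 1 (Metric.thickening δ K) := by
  obtain ⟨δ, hδ, hδΩ⟩ := hK.exists_cthickening_subset_open hΩ hKΩ
  obtain ⟨f, hf0, hf1, -⟩ := exists_contMDiffMap_zero_one_of_isClosed (n := 2)
    (modelWithCornersSelf ℝ E)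
    (Metric.isOpen_thickening (δ := δ) (E := K)).isClosed_compl
    (Metric.isClosed_cthickening (δ := δ / 2) (E := K))
    (Set.disjoint_compl_left_iff_subset.2
      (Metric.cthickening_subset_thickening' hδ (by linarith) K))
  have hsupp : tsupport f ⊆ Metric.cthickening δ K := by
    refine closure_minimal (fun x hx => ?_) Metric.isClosed_cthickening
    by_contra hxK
    exact hx (hf0 fun h => hxK (Metric.thickening_subset_cthickening _ _ h))
  exact ⟨δ / 2, by positivity, f, f.contMDiff.contDiff,
    hK.cthickening.of_isClosed_subset (isClosed_tsupport _) hsupp, hsupp.trans hδΩ,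
    hf1.mono (Metric.thickening_subset_cthickening _ _)⟩

theorem ContDiffOn.contDiff_smul_of_tsupport_subset {k : WithTop ℕ∞} {χ : E → ℝ} {f : E → F}
    {Ω : Set E} (hf : ContDiffOn ℝ k f Ω) (hΩ : IsOpen Ω) (hχ : ContDiff ℝ k χ)
    (hχΩ : tsupport χ ⊆ Ω) : ContDiff ℝ k fun x => χ x • f x := by
  rw [contDiff_iff_contDiffAt]
  intro x
  by_cases hx : x ∈ tsupport χ
  · exact hχ.contDiffAt.smul (hf.contDiffAt (hΩ.mem_nhds (hχΩ hx)))
  · refine (contDiffAt_const (c := (0 : F))).congr_of_eventuallyEq ?_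
    filter_upwards [notMem_tsupport_iff_eventuallyEq.1 hx] with y hy
    simp [hy]

end Cutoff

theorem pullMetric_congr {n m : ℕ} {u w : (Fin n → ℝ) → Fin m → ℝ} {x : Fin n → ℝ}
    (h : u =ᶠ[nhds x] w) (i j : Fin n) : pullMetric n m u i j x = pullMetric n m w i j x := by
  simp only [pullMetric, h.fderiv_eq]

theorem fderiv_convolution_apply {n m : ℕ} {ψ : (Fin n → ℝ) → ℝ} {R : ℝ}
    (h : IsMollifier volume ψ R) {V : (Fin n → ℝ) → Fin m → ℝ} (hV : ContDiff ℝ 1 V)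
    (hVc : HasCompactSupport V) (x e : Fin n → ℝ) (k : Fin m) :
    fderiv ℝ (ψ ⋆[lsmul ℝ ℝ, volume] V) x e k =
      (ψ ⋆[lsmul ℝ ℝ, volume] fun z => fderiv ℝ V z e k) x := by
  rw [(h.hasFDerivAt_convolution_of_contDiff hV hVc x).fderiv]
  exact h.clm_convolution (hV.continuous_fderiv one_ne_zero)
    ((ContinuousLinearMap.proj (R := ℝ) (φ := fun _ : Fin m => ℝ) k).comp
      (ContinuousLinearMap.apply ℝ (Fin m → ℝ) e)) x

theorem pullMetric_convolution_sub_estimate {n m : ℕ} {ψ : (Fin n → ℝ) → ℝ} {R : ℝ}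
    (h : IsMollifier volume ψ R) {V : (Fin n → ℝ) → Fin m → ℝ} (hV : ContDiff ℝ 1 V)
    (hVc : HasCompactSupport V) {x : Fin n → ℝ} {δ : ℝ} (hδ : 0 ≤ δ)
    (hVx : ∀ y ∈ Metric.ball x R, ‖fderiv ℝ V y - fderiv ℝ V x‖ ≤ δ) (i j : Fin n) :
    ∃ D : (Fin n → ℝ) →L[ℝ] ℝ,
      HasFDerivAt (fun y => pullMetric n m (ψ ⋆[lsmul ℝ ℝ, volume] V) i j y -
        (ψ ⋆[lsmul ℝ ℝ, volume] pullMetric n m V i j) y) D x ∧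
      |pullMetric n m (ψ ⋆[lsmul ℝ ℝ, volume] V) i j x -
        (ψ ⋆[lsmul ℝ ℝ, volume] pullMetric n m V i j) x| ≤ m * (2 * δ) ^ 2 ∧
      ‖D‖ ≤ m * ((∫ y, ‖fderiv ℝ ψ y‖) * (2 * δ) ^ 2) := by
  set a : Fin n → Fin m → (Fin n → ℝ) → ℝ := fun i k z => fderiv ℝ V z (Pi.single i 1) k with ha
  have hac : ∀ i k, Continuous (a i k) := fun i k =>
    (continuous_apply k).comp ((hV.continuous_fderiv one_ne_zero).clm_apply continuous_const)
  have hax : ∀ i k, ∀ y ∈ Metric.ball x R, |a i k y - a i k x| ≤ δ := by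
    intro i k y hy
    refine le_trans ?_ (hVx y hy)
    have h1 := (norm_le_pi_norm ((fderiv ℝ V y - fderiv ℝ V x) (Pi.single i 1)) k).trans
      ((fderiv ℝ V y - fderiv ℝ V x).le_opNorm _)
    simpa [ha, Pi.norm_single] using h1
  have hsum : ∀ y, (ψ ⋆[lsmul ℝ ℝ, volume] pullMetric n m V i j) y =
      ∑ k, (ψ ⋆[lsmul ℝ ℝ, volume] fun z => a i k z * a j k z) y := by
    intro y
    simp only [convolution_def]
    have hint : ∀ k ∈ Finset.univ,
        Integrable (fun t => lsmul ℝ ℝ (ψ t) (a i k (y - t) * a j k (y - t))) :=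
      fun k _ => h.convolutionExists ((hac i k).mul (hac j k)) y
    rw [← integral_finsetSum _ hint]
    simp only [pullMetric, map_sum, ha]
  have hfun : ∀ y, pullMetric n m (ψ ⋆[lsmul ℝ ℝ, volume] V) i j y -
        (ψ ⋆[lsmul ℝ ℝ, volume] pullMetric n m V i j) y =
      ∑ k, ((ψ ⋆[lsmul ℝ ℝ, volume] a i k) y * (ψ ⋆[lsmul ℝ ℝ, volume] a j k) y -
        (ψ ⋆[lsmul ℝ ℝ, volume] fun z => a i k z * a j k z) y) := by
    intro y
    rw [hsum, Finset.sum_sub_distrib]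
    simp only [pullMetric, fderiv_convolution_apply h hV hVc, ha]
  choose D hD hD0 hD1 using fun k =>
    h.commutator_estimate (hac i k) (hac j k) hδ (hax i k) (hax j k)
  refine ⟨∑ k, D k, ?_, ?_, ?_⟩
  · simp only [hfun]
    exact HasFDerivAt.fun_sum fun k _ => hD k
  · rw [hfun]
    refine (Finset.abs_sum_le_sum_abs _ _).trans ((Finset.sum_le_sum fun k _ => hD0 k).trans ?_)
    simp
  · refine (norm_sum_le _ _).trans ((Finset.sum_le_sum fun k _ => hD1 k).trans ?_)
    simp

/-- quadratic estimate of Conti–De Lellis–Székelyhidi: if `v ∈ C^{1,α}(Ω, ℝ^m)`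
with `v^♯e ∈ C²` and `φ` is a standard symmetric mollifier, then on every compact `K ⊆ Ω`
one has `‖(v∗φ_ε)^♯e − v^♯e‖_{C¹(K)} = O(ε^{2α−1})` as `ε → 0`. -/
theorem stmt7 (n m : ℕ) (α : ℝ) (hα : 1/2 < α) (hα1 : α < 1)
    (φ : (Fin n → ℝ) → ℝ) (hφsm : ContDiff ℝ (⊤ : ℕ∞) φ) (hφ0 : ∀ x, 0 ≤ φ x)
    (hφsupp : tsupport φ ⊆ Metric.closedBall 0 1) (hφint : ∫ x, φ x = 1)
    (hφsym : ∀ x, φ (-x) = φ x)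
    (Ω : Set (Fin n → ℝ)) (hΩ : IsOpen Ω)
    (v : (Fin n → ℝ) → Fin m → ℝ) (hv : ContDiffOn ℝ 1 v Ω)
    (hvH : ∃ H : ℝ, ∀ x ∈ Ω, ∀ y ∈ Ω, ‖fderiv ℝ v x - fderiv ℝ v y‖ ≤ H * ‖x - y‖ ^ α)
    (hmet : ∀ i j, ContDiffOn ℝ 2 (pullMetric n m v i j) Ω)
    (K : Set (Fin n → ℝ)) (hK : IsCompact K) (hKΩ : K ⊆ Ω) :
    ∃ C > 0, ∃ ε₀ > 0, ∀ ε : ℝ, 0 < ε → ε < ε₀ → ∀ x ∈ K, ∀ i j : Fin n,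
      |pullMetric n m (mollMap n m φ ε v) i j x - pullMetric n m v i j x| ≤
          C * ε ^ (2 * α - 1) ∧
      ‖fderiv ℝ (fun y =>
            pullMetric n m (mollMap n m φ ε v) i j y - pullMetric n m v i j y) x‖ ≤
          C * ε ^ (2 * α - 1) := by
  obtain ⟨H, hH⟩ := hvH
  obtain ⟨δ, hδ, χ, hχ, hχc, hχΩ, hχ1⟩ := exists_contDiff_cutoff hK hΩ hKΩ
  have hφ1 : ContDiff ℝ 1 φ := hφsm.of_le (by exact_mod_cast le_top)
  have hUΩ : Metric.thickening δ K ⊆ Ω := fun y hy =>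
    hχΩ (subset_tsupport χ (by simp [hχ1 hy]))
  set V : (Fin n → ℝ) → Fin m → ℝ := fun y => χ y • v y with hV_def
  have hV : ContDiff ℝ 1 V :=
    hv.contDiff_smul_of_tsupport_subset hΩ (hχ.of_le (by norm_num)) hχΩ
  have hVc : HasCompactSupport V := hχc.smul_right
  have hVv : Set.EqOn V v (Metric.thickening δ K) := fun y hy => by simp [hV_def, hχ1 hy]
  have hVvn : ∀ y ∈ Metric.thickening δ K, V =ᶠ[nhds y] v := fun y hy =>
    hVv.eventuallyEq_of_mem (Metric.isOpen_thickening.mem_nhds hy)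
  set g : Fin n → Fin n → (Fin n → ℝ) → ℝ := fun i j y => χ y • pullMetric n m v i j y with hg_def
  have hg : ∀ i j, ContDiff ℝ 2 (g i j) := fun i j =>
    (hmet i j).contDiff_smul_of_tsupport_subset hΩ hχ hχΩ
  have hgc : ∀ i j, HasCompactSupport (g i j) := fun i j => hχc.smul_right
  have hgv : ∀ i j, Set.EqOn (g i j) (pullMetric n m v i j) (Metric.thickening δ K) :=
    fun i j y hy => by simp [hg_def, hχ1 hy]
  have hLip : ∀ p : Fin n × Fin n, ∃ L : NNReal, LipschitzWith L (g p.1 p.2) ∧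
      LipschitzWith L (fderiv ℝ (g p.1 p.2)) := by
    intro p
    obtain ⟨L₁, h₁⟩ := (hg p.1 p.2).lipschitzWith_of_hasCompactSupport (hgc _ _) two_ne_zero
    obtain ⟨L₂, h₂⟩ := ContDiff.lipschitzWith_of_hasCompactSupport ((hgc p.1 p.2).fderiv ℝ)
      ((hg p.1 p.2).fderiv_right (m := 1) (by norm_num)) one_ne_zero
    exact ⟨max L₁ L₂, h₁.weaken (le_max_left _ _), h₂.weaken (le_max_right _ _)⟩
  choose Lp hLp hLp' using hLip
  set L : NNReal := ∑ p, Lp p with hL_def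
  have hLpL : ∀ p, Lp p ≤ L := fun p =>
    Finset.single_le_sum (fun _ _ => zero_le) (Finset.mem_univ p)
  set B : ℝ := ∫ y, ‖fderiv ℝ φ y‖ with hB_def
  have hB : 0 ≤ B := integral_nonneg fun _ => norm_nonneg _
  refine ⟨m * (16 * H ^ 2) * (1 + B) + 2 * L + 1, by positivity, min 1 (δ / 4), by positivity, ?_⟩
  intro ε hε hεlt x hx i j
  have hε1 : ε < 1 := hεlt.trans_le (min_le_left _ _)
  have hεδ : ε < δ / 4 := hεlt.trans_le (min_le_right _ _)
  set ψ : (Fin n → ℝ) → ℝ := fun y => (ε ^ n)⁻¹ * φ (ε⁻¹ • y) with hψ_def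
  have hψ : IsMollifier volume ψ (2 * ε) := isMollifier_rescale hφ1 hφ0 hφsupp hφint hε
  have hψB : ∫ y, ‖fderiv ℝ ψ y‖ = ε⁻¹ * B := integral_norm_fderiv_rescale hφ1 hε
  have hball : ∀ y ∈ Metric.thickening (δ / 4) K,
      Metric.ball y (2 * ε) ⊆ Metric.thickening δ K := by
    intro y hy z hz
    obtain ⟨w, hw, hyw⟩ := Metric.mem_thickening_iff.1 hy
    refine Metric.mem_thickening_iff.2 ⟨w, hw, ?_⟩
    have := dist_triangle z y w
    have := Metric.mem_ball.1 hz
    linarith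
  have hW : Metric.thickening (δ / 4) K ∈ nhds x :=
    Metric.isOpen_thickening.mem_nhds (Metric.self_subset_thickening (by positivity) K hx)
  have hxU : x ∈ Metric.thickening δ K := Metric.self_subset_thickening hδ K hx
  have hmoll : ∀ y ∈ Metric.thickening (δ / 4) K,
      mollMap n m φ ε v y = (ψ ⋆[lsmul ℝ ℝ, volume] V) y := fun y hy =>
    hψ.convolution_congr_of_eqOn_ball (hVv.symm.mono (hball y hy))
  have hmet_moll : ∀ y ∈ Metric.thickening (δ / 4) K,
      pullMetric n m (mollMap n m φ ε v) i j y =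
        pullMetric n m (ψ ⋆[lsmul ℝ ℝ, volume] V) i j y := fun y hy =>
    pullMetric_congr (Filter.eventually_of_mem (Metric.isOpen_thickening.mem_nhds hy) hmoll) i j
  have hconv : ∀ y ∈ Metric.thickening (δ / 4) K,
      (ψ ⋆[lsmul ℝ ℝ, volume] pullMetric n m V i j) y = (ψ ⋆[lsmul ℝ ℝ, volume] g i j) y := by
    refine fun y hy => hψ.convolution_congr_of_eqOn_ball fun z hz => ?_
    rw [hgv i j (hball y hy hz), pullMetric_congr (hVvn z (hball y hy hz))]
  have hsplit : ∀ y ∈ Metric.thickening (δ / 4) K,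
      pullMetric n m (mollMap n m φ ε v) i j y - pullMetric n m v i j y =
        (pullMetric n m (ψ ⋆[lsmul ℝ ℝ, volume] V) i j y -
          (ψ ⋆[lsmul ℝ ℝ, volume] pullMetric n m V i j) y) +
        ((ψ ⋆[lsmul ℝ ℝ, volume] g i j) y - g i j y) := by
    intro y hy
    rw [hmet_moll y hy, hconv y hy, hgv i j (Metric.thickening_mono (by linarith) K hy)]
    ring
  have hHolder : ∀ y ∈ Metric.ball x (2 * ε),
      ‖fderiv ℝ V y - fderiv ℝ V x‖ ≤ |H| * (2 * ε) ^ α := by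
    intro y hy
    have hyU := hball x (Metric.self_subset_thickening (by positivity) K hx) hy
    rw [(hVvn y hyU).fderiv_eq, (hVvn x hxU).fderiv_eq]
    refine (hH y (hUΩ hyU) x (hUΩ hxU)).trans (mul_le_mul (le_abs_self H) ?_ (by positivity)
      (abs_nonneg H))
    exact Real.rpow_le_rpow (norm_nonneg _) (mem_ball_iff_norm.1 hy).le (by linarith)
  obtain ⟨D₁, hD₁, hv₁, hn₁⟩ := pullMetric_convolution_sub_estimate hψ hV hVc
    (by positivity : 0 ≤ |H| * (2 * ε) ^ α) hHolder i j
  obtain ⟨D₂, hD₂, hv₂, hn₂⟩ := hψ.convolution_sub_self_estimate ((hg i j).of_le (by norm_num))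
    (hgc i j) ((hLp (i, j)).weaken (hLpL _)) ((hLp' (i, j)).weaken (hLpL _)) (by positivity) x
  set t : ℝ := ε ^ (2 * α - 1) with ht_def
  have ht : 0 ≤ t := by positivity
  have hεt : ε ≤ t := by
    simpa using Real.rpow_le_rpow_of_exponent_ge hε hε1.le (by linarith : 2 * α - 1 ≤ 1)
  have hsq : (2 * (|H| * (2 * ε) ^ α)) ^ 2 ≤ 16 * H ^ 2 * (ε * t) := by
    have h1 : (ε ^ α) ^ 2 = ε * t := by
      rw [ht_def, ← Real.rpow_natCast, ← Real.rpow_mul hε.le,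
        ← Real.rpow_one_add' hε.le (by linarith)]
      congr 1
      push_cast
      ring
    have h2 : (2 : ℝ) ^ α ≤ 2 := by
      simpa using Real.rpow_le_rpow_of_exponent_le one_le_two hα1.le
    have h3 : ((2 : ℝ) ^ α) ^ 2 ≤ 4 := by nlinarith [Real.rpow_nonneg zero_le_two α]
    have h4 : (2 * (|H| * (2 * ε) ^ α)) ^ 2 = 4 * H ^ 2 * (ε ^ α) ^ 2 * ((2 : ℝ) ^ α) ^ 2 := by
      rw [Real.mul_rpow zero_le_two hε.le, ← sq_abs H]
      ring
    rw [h4, h1]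
    nlinarith [mul_le_mul_of_nonneg_left h3 (by positivity : 0 ≤ 4 * H ^ 2 * (ε * t))]
  have hder : fderiv ℝ (fun y =>
      pullMetric n m (mollMap n m φ ε v) i j y - pullMetric n m v i j y) x = D₁ + D₂ :=
    ((hD₁.add hD₂).congr_of_eventuallyEq (Filter.eventually_of_mem hW hsplit)).fderiv
  have hLε : L * (2 * ε) ≤ 2 * L * t := by nlinarith [L.coe_nonneg]
  have hcm : 0 ≤ (m : ℝ) * (16 * H ^ 2) * t := by positivity
  rw [hder, hsplit x (mem_of_mem_nhds hW)]
  constructor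
  · have h1 : (m : ℝ) * (2 * (|H| * (2 * ε) ^ α)) ^ 2 ≤ m * (16 * H ^ 2) * t := by
      rw [mul_assoc]
      refine mul_le_mul_of_nonneg_left (hsq.trans ?_) m.cast_nonneg
      exact mul_le_mul_of_nonneg_left (mul_le_of_le_one_left ht hε1.le) (by positivity)
    refine (abs_add_le _ _).trans ?_
    nlinarith [mul_nonneg hcm hB]
  · have h1 : (m : ℝ) * ((∫ y, ‖fderiv ℝ ψ y‖) * (2 * (|H| * (2 * ε) ^ α)) ^ 2) ≤
        m * (16 * H ^ 2) * t * B := by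
      calc _ ≤ (m : ℝ) * ((ε⁻¹ * B) * (16 * H ^ 2 * (ε * t))) := by
            rw [hψB]
            gcongr
        _ = _ := by field_simp
    refine (norm_add_le _ _).trans ?_
    nlinarith [mul_nonneg hcm hB]
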